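/- Let P, Q be bounded-above cochain complexes of abelian groups (or sheaves of abelian groups), with P^x = 0 for x > a and Q^y = 0 for y > b, and assume P^a and Q^b are flat over ℤ. Then the quotient of τ_{≥ a+b−1}(P ⊗ Q) by the image of (Ker ∂_P^{a−1} ⊗ Q^b ⊕ P^a ⊗ Ker ∂_Q^{b−1})[1−a−b] is quasi-isomorphic to the complex concentrated in degrees a+b−1 and a+b given by (Im ∂_P^{a−1} ⊗ Im ∂_Q^{b−1}) → (Im ∂_P^{a−1} ⊗ Q^b ⊕ P^a ⊗ Im ∂_Q^{b−1}) → P^a ⊗ Q^b after truncation τ_{≥ a+b−1}, and hence its class in the derived category equals H^a(P)[−a] ⊗^L H^b(Q)[−b]. -/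

import Mathlib

open TensorProduct CategoryTheory

/-!
STATEMENT 3.  Let `P, Q` be bounded-above cochain complexes of abelian groups,
vanishing above degrees `a = a₀ + 1 + 1` and `b = b₀ + 1 + 1` respectively,
with `P^a` and `Q^b` flat over `ℤ`.  The quotient of `τ_{≥ a+b−1}(P ⊗ Q)` by
the image of `(Ker ∂_P^{a−1} ⊗ Q^b ⊕ P^a ⊗ Ker ∂_Q^{b−1})[1−a−b]` is a
two-term complex `[Q1 → P^a ⊗ Q^b]` (in degrees `a+b−1`, `a+b`), where `Q1` is
the quotient of `(P^{a−1} ⊗ Q^b) × (P^a ⊗ Q^{b−1})` by the span `N` of the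
image of the total differential from degree `a+b−2` together with the kernel
subcomplex; and the claims are:
 * this two-term complex is isomorphic (in particular quasi-isomorphic) to
   `τ_{≥ a+b−1}` of the three-term complex
   `Im ∂_P ⊗ Im ∂_Q → (Im ∂_P ⊗ Q^b) ⊕ (P^a ⊗ Im ∂_Q) → P^a ⊗ Q^b`,
   via the map induced by `∂ ⊗ 1` and `1 ⊗ ∂`;
 * the three-term complex computes `H^a(P)[−a] ⊗^L H^b(Q)[−b]`: its first map
   `δ2` is injective (by flatness of the flat resolutions, statement 4), its
   top cohomology is `H^a(P) ⊗ H^b(Q)`, and its middle cohomology is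
   `Tor₁^ℤ(H^a(P), H^b(Q))`.
-/

/-- A cochain complex of abelian groups indexed by `ℤ`. -/
structure Cx : Type 1 where
  X : ℤ → Type
  [inst : ∀ n, AddCommGroup (X n)]
  d : ∀ n, X n →+ X (n + 1)
  dsq : ∀ (n : ℤ) (x : X n), d (n + 1) (d n x) = 0

attribute [instance] Cx.inst

namespace Stmt3

variable (P Q : Cx) (a₀ b₀ : ℤ)

/-- The top differential of `P`, as a `ℤ`-linear map `P^{a-1} → P^a`. -/
noncomputable def dPl : P.X (a₀ + 1) →ₗ[ℤ] P.X (a₀ + 1 + 1) :=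
  (P.d (a₀ + 1)).toIntLinearMap

/-- The top differential of `Q`. -/
noncomputable def dQl : Q.X (b₀ + 1) →ₗ[ℤ] Q.X (b₀ + 1 + 1) :=
  (Q.d (b₀ + 1)).toIntLinearMap

/-- `Im ∂_P^{a-1} ⊆ P^a`. -/
noncomputable def IP : Submodule ℤ (P.X (a₀ + 1 + 1)) := LinearMap.range (dPl P a₀)

/-- `Im ∂_Q^{b-1} ⊆ Q^b`. -/
noncomputable def IQ : Submodule ℤ (Q.X (b₀ + 1 + 1)) := LinearMap.range (dQl Q b₀)

/-- `H^a(P) = P^a / Im ∂_P^{a-1}` (using that `P` vanishes above degree `a`). -/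
abbrev HaP := P.X (a₀ + 1 + 1) ⧸ IP P a₀

/-- `H^b(Q)`. -/
abbrev HbQ := Q.X (b₀ + 1 + 1) ⧸ IQ Q b₀

/-- The inclusion `Im ∂_P ⊆ P^a`. -/
noncomputable def jP : (IP P a₀) →ₗ[ℤ] P.X (a₀ + 1 + 1) := (IP P a₀).subtype

/-- The inclusion `Im ∂_Q ⊆ Q^b`. -/
noncomputable def jQ : (IQ Q b₀) →ₗ[ℤ] Q.X (b₀ + 1 + 1) := (IQ Q b₀).subtype

/-- The first map of the three-term complex:
`Im ∂_P ⊗ Im ∂_Q → (Im ∂_P ⊗ Q^b) ⊕ (P^a ⊗ Im ∂_Q)` (with Koszul signs). -/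
noncomputable def δ2 :
    ((IP P a₀) ⊗[ℤ] (IQ Q b₀)) →ₗ[ℤ]
      ((IP P a₀) ⊗[ℤ] Q.X (b₀ + 1 + 1)) × (P.X (a₀ + 1 + 1) ⊗[ℤ] (IQ Q b₀)) :=
  LinearMap.prod
    (((a₀ + 1).negOnePow : ℤ) • TensorProduct.map LinearMap.id (jQ Q b₀))
    (TensorProduct.map (jP P a₀) LinearMap.id)

/-- The second map of the three-term complex:
`(Im ∂_P ⊗ Q^b) ⊕ (P^a ⊗ Im ∂_Q) → P^a ⊗ Q^b`. -/
noncomputable def δ1 :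
    (((IP P a₀) ⊗[ℤ] Q.X (b₀ + 1 + 1)) × (P.X (a₀ + 1 + 1) ⊗[ℤ] (IQ Q b₀)))
      →ₗ[ℤ] (P.X (a₀ + 1 + 1) ⊗[ℤ] Q.X (b₀ + 1 + 1)) :=
  LinearMap.coprod
    (TensorProduct.map (jP P a₀) LinearMap.id)
    (((a₀ + 1 + 1).negOnePow : ℤ) • TensorProduct.map LinearMap.id (jQ Q b₀))

/-- The ambient group of the degree `a+b-1` term of
`τ_{≥ a+b−1}(P ⊗ Q)`: `(P^{a-1} ⊗ Q^b) × (P^a ⊗ Q^{b-1})` (the other graded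
pieces vanish). -/
abbrev G1 :=
  (P.X (a₀ + 1) ⊗[ℤ] Q.X (b₀ + 1 + 1)) × (P.X (a₀ + 1 + 1) ⊗[ℤ] Q.X (b₀ + 1))

/-- The submodule by which one divides: the image of the differential from
degree `a+b-2` (giving the canonical truncation) together with the image of
`Ker ∂_P^{a−1} ⊗ Q^b ⊕ P^a ⊗ Ker ∂_Q^{b−1}`. -/
noncomputable def Nsub : Submodule ℤ (G1 P Q a₀ b₀) :=
  Submodule.span ℤ
    ({w | ∃ (x : P.X a₀) (y : Q.X (b₀ + 1 + 1)),
        w = ((P.d a₀ x) ⊗ₜ y, 0)} ∪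
     {w | ∃ (x : P.X (a₀ + 1)) (y : Q.X (b₀ + 1)),
        w = (((a₀ + 1).negOnePow : ℤ) • (x ⊗ₜ (Q.d (b₀ + 1) y)),
             (P.d (a₀ + 1) x) ⊗ₜ y)} ∪
     {w | ∃ (x : P.X (a₀ + 1 + 1)) (y : Q.X b₀),
        w = (0, ((a₀ + 1 + 1).negOnePow : ℤ) • (x ⊗ₜ (Q.d b₀ y)))} ∪
     {w | ∃ (x : LinearMap.ker (dPl P a₀)) (y : Q.X (b₀ + 1 + 1)),
        w = ((x : P.X (a₀ + 1)) ⊗ₜ y, 0)} ∪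
     {w | ∃ (x : P.X (a₀ + 1 + 1)) (y : LinearMap.ker (dQl Q b₀)),
        w = (0, x ⊗ₜ (y : Q.X (b₀ + 1)))})

/-- The degree `a+b-1` term of the quotient complex. -/
abbrev Q1 := (G1 P Q a₀ b₀) ⧸ (Nsub P Q a₀ b₀)

/-- The comparison map `(P^{a-1} ⊗ Q^b) × (P^a ⊗ Q^{b-1}) →
(Im ∂_P ⊗ Q^b) × (P^a ⊗ Im ∂_Q)` given by `∂ ⊗ 1` and `1 ⊗ ∂`. -/
noncomputable def gmap : (G1 P Q a₀ b₀) →ₗ[ℤ]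
    (((IP P a₀) ⊗[ℤ] Q.X (b₀ + 1 + 1)) × (P.X (a₀ + 1 + 1) ⊗[ℤ] (IQ Q b₀))) :=
  LinearMap.prodMap
    (TensorProduct.map (dPl P a₀).rangeRestrict LinearMap.id)
    (TensorProduct.map LinearMap.id (dQl Q b₀).rangeRestrict)

/-- The differential of the quotient complex `G1 → P^a ⊗ Q^b` (total
differential of `P ⊗ Q` in top degree). -/
noncomputable def δG1 : (G1 P Q a₀ b₀) →ₗ[ℤ]
    (P.X (a₀ + 1 + 1) ⊗[ℤ] Q.X (b₀ + 1 + 1)) :=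
  LinearMap.coprod
    (TensorProduct.map (dPl P a₀) LinearMap.id)
    (((a₀ + 1 + 1).negOnePow : ℤ) • TensorProduct.map LinearMap.id (dQl Q b₀))

section Algebra

universe u

variable {R : Type u} [CommRing R]

/-- A form of the first isomorphism theorem. -/
theorem nonempty_quotient_equiv_of_surjective {A B : Type*} [AddCommGroup A] [Module R A]
    [AddCommGroup B] [Module R B] (f : A →ₗ[R] B) (hf : Function.Surjective f)
    (S : Submodule R A) (h : ∀ t, f t = 0 ↔ t ∈ S) : Nonempty ((A ⧸ S) ≃ₗ[R] B) :=
  ⟨(Submodule.quotEquivOfEq _ _ (Submodule.ext fun t => (h t).symm)).trans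
    (f.quotKerEquivOfSurjective hf)⟩

open LinearMap in
/-- Let `F₂ → F₁ → F₀` be the beginning of a resolution of `N ⧸ J` with `N` flat. Then the homology
of `X ⊗ F₂ → X ⊗ F₁ → X ⊗ F₀` is the kernel of `X ⊗ J → X ⊗ N`. -/
theorem exists_ker_lTensor_resolution_to_ker_lTensor_subtype
    {X F₂ F₁ F₀ N : Type*} [AddCommGroup X] [Module R X] [AddCommGroup F₂] [Module R F₂]
    [AddCommGroup F₁] [Module R F₁] [AddCommGroup F₀] [Module R F₀] [AddCommGroup N] [Module R N]
    [Module.Flat R N] (J : Submodule R N) (d : F₂ →ₗ[R] F₁) (e : F₁ →ₗ[R] F₀) (s : F₀ →ₗ[R] N)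
    (hde : Function.Exact d e) (hes : Function.Exact e (J.mkQ ∘ₗ s))
    (hs : Function.Surjective (J.mkQ ∘ₗ s)) :
    ∃ f : ker (e.lTensor X) →ₗ[R] ker (J.subtype.lTensor X), Function.Surjective f ∧
      ∀ t, f t = 0 ↔ (t : X ⊗[R] F₁) ∈ range (d.lTensor X) := by
  have hmem : ∀ t, s (e t) ∈ J := fun t => by
    have := hes.apply_apply_eq_zero t
    simpa using this
  let r : F₁ →ₗ[R] J := (s ∘ₗ e).codRestrict J hmem
  let g : F₁ →ₗ[R] F₀ × J := e.prod r
  let p : F₀ × J →ₗ[R] N := s.coprod (-J.subtype)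
  have hgp : Function.Exact g p := by
    rintro ⟨x, j⟩
    constructor
    · intro h
      have h' : s x = j := by simpa [p, ← sub_eq_add_neg, sub_eq_zero] using h
      obtain ⟨t, rfl⟩ := (hes x).1 (by simp [h'])
      exact ⟨t, Prod.ext rfl (Subtype.ext h')⟩
    · rintro ⟨t, ht⟩
      rw [← ht]
      simp [p, g, r]
  have hp : Function.Surjective p := by
    intro n
    obtain ⟨x, hx⟩ := hs (J.mkQ n)
    have hj : s x - n ∈ J := (Submodule.Quotient.eq J).1 hx
    exact ⟨(x, ⟨s x - n, hj⟩), by simp [p]⟩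
  let g' : F₁ →ₗ[R] ker p := g.codRestrict (ker p) fun t => hgp.apply_apply_eq_zero t
  have hg' : Function.Surjective g' := by
    rintro ⟨w, hw⟩
    obtain ⟨t, ht⟩ := (hgp w).1 hw
    exact ⟨t, Subtype.ext ht⟩
  have hdg' : Function.Exact d g' := by
    intro t
    rw [← hde t]
    constructor
    · intro h
      exact congrArg (fun w : ker p => w.1.1) h
    · intro h
      exact Subtype.ext (Prod.ext h (Subtype.ext (by
        change s (e t) = 0
        rw [h, map_zero])))
  have hι := LinearMap.lTensor_injective_of_exact_of_flat p hp (ker p).subtype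
    (Submodule.subtype_injective _) (LinearMap.exact_subtype_ker_map p) X
  have hg : ∀ t, g.lTensor X t = (ker p).subtype.lTensor X (g'.lTensor X t) := fun t => by
    rw [← lTensor_comp_apply]; rfl
  have hker : ∀ t, g.lTensor X t = 0 ↔ t ∈ range (d.lTensor X) := fun t => by
    rw [hg, map_eq_zero_iff _ hι]
    exact lTensor_exact X hdg' hg' t
  have hsplit : ∀ t, g.lTensor X t =
      (inl R F₀ J).lTensor X (e.lTensor X t) + (inr R F₀ J).lTensor X (r.lTensor X t) := by
    intro t
    rw [← lTensor_comp_apply, ← lTensor_comp_apply, ← LinearMap.add_apply, ← lTensor_add]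
    congr 2
    ext x <;> simp [g]
  have hsr : ∀ t, J.subtype.lTensor X (r.lTensor X t) = s.lTensor X (e.lTensor X t) := fun t => by
    rw [← lTensor_comp_apply, ← lTensor_comp_apply]; rfl
  refine ⟨(r.lTensor X).restrict fun t ht => ?_, ?_, ?_⟩
  · rw [mem_ker] at ht ⊢
    rw [hsr, ht, map_zero]
  · rintro ⟨z, hz⟩
    have hw : p.lTensor X ((inr R F₀ J).lTensor X z) = 0 := by
      rw [← lTensor_comp_apply]
      have : p ∘ₗ inr R F₀ J = -J.subtype := by ext; simp [p]
      rw [this, lTensor_neg, LinearMap.neg_apply, mem_ker.1 hz, neg_zero]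
    obtain ⟨t, ht⟩ := (lTensor_exact X hgp hp _).1 hw
    refine ⟨⟨t, ?_⟩, Subtype.ext ?_⟩
    · have := congrArg ((fst R F₀ J).lTensor X) ht
      simp only [← lTensor_comp_apply] at this
      simpa [g] using this
    · have := congrArg ((snd R F₀ J).lTensor X) ht
      simp only [← lTensor_comp_apply] at this
      simpa [g] using this
  · rintro ⟨t, ht⟩
    have hte : (inl R F₀ J).lTensor X (e.lTensor X t) = 0 := by rw [mem_ker.1 ht, map_zero]
    rw [← hker, hsplit, hte, zero_add, ← Subtype.coe_inj]
    refine ⟨fun h => ?_, fun h => ?_⟩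
    · have h' : r.lTensor X t = 0 := h
      rw [h', map_zero]
    · have := congrArg ((snd R F₀ J).lTensor X) h
      rw [map_zero, ← lTensor_comp_apply, snd_comp_inr, lTensor_id, LinearMap.id_apply] at this
      exact this

/-- `Tor₁(X, N ⧸ J)` is the kernel of `X ⊗ J → X ⊗ N` when `N` is flat. -/
theorem nonempty_Tor_one_equiv_ker_lTensor_subtype (X : ModuleCat.{u} R) {N : Type u}
    [AddCommGroup N] [Module R N] [Module.Flat R N] (J : Submodule R N) :
    Nonempty ((((Tor (ModuleCat.{u} R) 1).obj X).obj (ModuleCat.of R (N ⧸ J))) ≃ₗ[R]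
      LinearMap.ker (J.subtype.lTensor X)) := by
  let S := projectiveResolution (ModuleCat.of R (N ⧸ J))
  let π₀ : S.complex.X 0 ⟶ ModuleCat.of R (N ⧸ J) := S.π.f 0
  have : Epi π₀ := inferInstanceAs (Epi (S.π.f 0))
  let q : ModuleCat.of R N ⟶ ModuleCat.of R (N ⧸ J) := ModuleCat.ofHom J.mkQ
  have : Epi q := (ModuleCat.epi_iff_surjective q).2 J.mkQ_surjective
  let s : S.complex.X 0 ⟶ ModuleCat.of R N := Projective.factorThru π₀ q
  have hs : J.mkQ ∘ₗ s.hom = π₀.hom :=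
    congrArg ModuleCat.Hom.hom (Projective.factorThru_comp π₀ q)
  obtain ⟨f, hf, hf'⟩ := exists_ker_lTensor_resolution_to_ker_lTensor_subtype (X := X) J
    (S.complex.d 2 1).hom (S.complex.d 1 0).hom s.hom
    ((ShortComplex.ShortExact.moduleCat_exact_iff_function_exact _).1 (S.exact_succ 0))
    (hs ▸ (ShortComplex.ShortExact.moduleCat_exact_iff_function_exact _).1 S.exact₀)
    (hs ▸ (ModuleCat.epi_iff_surjective π₀).1 inferInstance)
  let K := (((MonoidalCategory.tensoringLeft (ModuleCat.{u} R)).obj X).mapHomologicalComplex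
    (ComplexShape.down ℕ)).obj S.complex
  let T := K.sc' 2 1 0
  let i : (((Tor (ModuleCat.{u} R) 1).obj X).obj (ModuleCat.of R (N ⧸ J))) ≅
      T.moduleCatLeftHomologyData.H :=
    S.isoLeftDerivedObj _ 1 ≪≫ ShortComplex.homologyMapIso (K.isoSc' 2 1 0 (by simp) (by simp)) ≪≫
      T.moduleCatHomologyIso
  have hT : ∃ f : LinearMap.ker T.g.hom →ₗ[R] LinearMap.ker (J.subtype.lTensor X),
      Function.Surjective f ∧ ∀ t, f t = 0 ↔ t ∈ LinearMap.range T.moduleCatToCycles :=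
    ⟨f, hf, fun t => (hf' t).trans
      ⟨fun ⟨x, hx⟩ => ⟨x, Subtype.ext hx⟩, fun ⟨x, hx⟩ => ⟨x, congrArg Subtype.val hx⟩⟩⟩
  obtain ⟨f', hsurj, hker⟩ := hT
  obtain ⟨e⟩ := nonempty_quotient_equiv_of_surjective f' hsurj _ hker
  exact ⟨i.toLinearEquiv ≪≫ₗ e⟩

open LinearMap in
/-- The middle homology of `I ⊗ J → (I ⊗ N) × (M ⊗ J) → M ⊗ N` is the kernel of
`(M ⧸ I) ⊗ J → (M ⧸ I) ⊗ N` when `N` is flat. -/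
theorem exists_ker_koszul_to_ker_lTensor_subtype {M N : Type*} [AddCommGroup M] [Module R M]
    [AddCommGroup N] [Module R N] [Module.Flat R N] (I : Submodule R M) (J : Submodule R N)
    (ε ε' : R) (hε : ε * ε = 1) (hε' : ε' = -ε) :
    ∃ f : ker ((I.subtype.rTensor N).coprod (ε' • J.subtype.lTensor M)) →ₗ[R]
        ker (J.subtype.lTensor (M ⧸ I)), Function.Surjective f ∧
      ∀ t, f t = 0 ↔ (t : (I ⊗[R] N) × (M ⊗[R] J)) ∈
        range ((ε • J.subtype.lTensor I).prod (I.subtype.rTensor J)) := by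
  subst hε'
  have hI : Function.Injective (I.subtype.rTensor N) :=
    Module.Flat.rTensor_preserves_injective_linearMap _ I.subtype_injective
  have hex : Function.Exact I.subtype I.mkQ := LinearMap.exact_subtype_mkQ I
  have hJ : ∀ v, J.subtype.lTensor (M ⧸ I) (I.mkQ.rTensor J v) =
      I.mkQ.rTensor N (J.subtype.lTensor M v) := fun v => by
    rw [← LinearMap.comp_apply, ← LinearMap.comp_apply, lTensor_comp_rTensor, rTensor_comp_lTensor]
  have hIJ : ∀ z, J.subtype.lTensor M (I.subtype.rTensor J z) =
      I.subtype.rTensor N (J.subtype.lTensor I z) := fun v => by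
    rw [← LinearMap.comp_apply, ← LinearMap.comp_apply, lTensor_comp_rTensor, rTensor_comp_lTensor]
  have hmem : ∀ t, t ∈ ker ((I.subtype.rTensor N).coprod (-ε • J.subtype.lTensor M)) ↔
      I.subtype.rTensor N t.1 = ε • J.subtype.lTensor M t.2 := fun t => by
    simp [← sub_eq_add_neg, sub_eq_zero]
  have hsmul : ∀ {A : Type _} [AddCommGroup A] [Module R A] (x : A), ε • ε • x = x := by
    intro A _ _ x
    rw [smul_smul, hε, one_smul]
  refine ⟨(I.mkQ.rTensor J ∘ₗ snd R (I ⊗[R] N) (M ⊗[R] J)).restrict fun t ht => ?_, ?_, ?_⟩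
  · rw [hmem] at ht
    rw [mem_ker, LinearMap.comp_apply, snd_apply, hJ, ← hsmul (J.subtype.lTensor M t.2), ← ht, map_smul,
      (rTensor_exact N hex I.mkQ_surjective).apply_apply_eq_zero, smul_zero]
  · rintro ⟨z, hz⟩
    obtain ⟨v, rfl⟩ := rTensor_surjective J I.mkQ_surjective z
    rw [mem_ker, hJ] at hz
    obtain ⟨u, hu⟩ := (rTensor_exact N hex I.mkQ_surjective _).1 hz
    exact ⟨⟨(ε • u, v), (hmem _).2 (by rw [map_smul, hu])⟩, rfl⟩
  · rintro ⟨⟨u, v⟩, ht⟩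
    rw [hmem] at ht
    rw [← Subtype.coe_inj]
    change I.mkQ.rTensor J v = 0 ↔ _
    rw [rTensor_exact J hex I.mkQ_surjective v]
    refine ⟨?_, ?_⟩
    · rintro ⟨z, rfl⟩
      refine ⟨z, Prod.ext (hI ?_) rfl⟩
      simp only at ht
      rw [ht, hIJ]
      simp
    · rintro ⟨z, hz⟩
      exact ⟨z, congrArg Prod.snd hz⟩

/-- The top homology of `I ⊗ J → (I ⊗ N) × (M ⊗ J) → M ⊗ N` is `(M ⧸ I) ⊗ (N ⧸ J)`. -/
theorem exists_quotient_range_coprod_equiv {M N : Type*} [AddCommGroup M] [Module R M]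
    [AddCommGroup N] [Module R N] (I : Submodule R M) (J : Submodule R N) (ε : R)
    (hε : ε * ε = 1) :
    ∃ e : ((M ⊗[R] N) ⧸ LinearMap.range ((TensorProduct.map I.subtype LinearMap.id).coprod
        (ε • TensorProduct.map LinearMap.id J.subtype))) ≃ₗ[R] ((M ⧸ I) ⊗[R] (N ⧸ J)),
      ∀ x y, e (Submodule.Quotient.mk (x ⊗ₜ y)) =
        (Submodule.Quotient.mk x : M ⧸ I) ⊗ₜ (Submodule.Quotient.mk y : N ⧸ J) := by
  have h : LinearMap.range ((TensorProduct.map I.subtype LinearMap.id).coprod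
        (ε • TensorProduct.map LinearMap.id J.subtype)) =
      LinearMap.range (TensorProduct.map I.subtype (LinearMap.id : N →ₗ[R] N)) ⊔
        LinearMap.range (TensorProduct.map (LinearMap.id : M →ₗ[R] M) J.subtype) := by
    rw [LinearMap.range_coprod]
    congr 1
    ext z
    constructor
    · rintro ⟨w, rfl⟩
      exact ⟨ε • w, map_smul _ _ _⟩
    · rintro ⟨w, rfl⟩
      exact ⟨ε • w, by rw [LinearMap.smul_apply, map_smul, smul_smul, hε, one_smul]⟩
  exact ⟨(Submodule.quotEquivOfEq _ _ h).trans
    (TensorProduct.quotientTensorQuotientEquiv I J).symm, fun x y => rfl⟩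

end Algebra

theorem negOnePow_mul_self (n : ℤ) : (n.negOnePow : ℤ) * n.negOnePow = 1 := by
  rw [← Units.val_mul, Int.units_mul_self, Units.val_one]

theorem negOnePow_add_one (n : ℤ) : ((n + 1).negOnePow : ℤ) = -n.negOnePow := by
  rw [Int.negOnePow_succ, Units.val_neg]

/-- The differential `P^{a-1} → P^a`, with values in its image. -/
noncomputable def toIP : P.X (a₀ + 1) →ₗ[ℤ] IP P a₀ := (dPl P a₀).rangeRestrict

/-- The differential `Q^{b-1} → Q^b`, with values in its image. -/
noncomputable def toIQ : Q.X (b₀ + 1) →ₗ[ℤ] IQ Q b₀ := (dQl Q b₀).rangeRestrict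

theorem toIP_surjective : Function.Surjective (toIP P a₀) := (dPl P a₀).surjective_rangeRestrict

theorem toIQ_surjective : Function.Surjective (toIQ Q b₀) := (dQl Q b₀).surjective_rangeRestrict

theorem ker_toIP : LinearMap.ker (toIP P a₀) = LinearMap.ker (dPl P a₀) :=
  (dPl P a₀).ker_rangeRestrict

theorem ker_toIQ : LinearMap.ker (toIQ Q b₀) = LinearMap.ker (dQl Q b₀) :=
  (dQl Q b₀).ker_rangeRestrict

theorem δ1_apply (u : (IP P a₀) ⊗[ℤ] Q.X (b₀ + 1 + 1)) (v : P.X (a₀ + 1 + 1) ⊗[ℤ] (IQ Q b₀)) :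
    δ1 P Q a₀ b₀ (u, v) = (IP P a₀).subtype.rTensor _ u +
      ((a₀ + 1 + 1).negOnePow : ℤ) • (IQ Q b₀).subtype.lTensor _ v :=
  rfl

theorem δ2_apply (z : (IP P a₀) ⊗[ℤ] (IQ Q b₀)) :
    δ2 P Q a₀ b₀ z = (((a₀ + 1).negOnePow : ℤ) • (IQ Q b₀).subtype.lTensor _ z,
      (IP P a₀).subtype.rTensor _ z) :=
  rfl

theorem gmap_apply (u : P.X (a₀ + 1) ⊗[ℤ] Q.X (b₀ + 1 + 1))
    (v : P.X (a₀ + 1 + 1) ⊗[ℤ] Q.X (b₀ + 1)) :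
    gmap P Q a₀ b₀ (u, v) = ((toIP P a₀).rTensor _ u,
      (toIQ Q b₀).lTensor _ v) :=
  rfl

theorem δ1_comp_δ2 : (δ1 P Q a₀ b₀).comp (δ2 P Q a₀ b₀) = 0 := by
  refine TensorProduct.ext' fun x y => ?_
  change δ1 P Q a₀ b₀ (δ2 P Q a₀ b₀ (x ⊗ₜ y)) = 0
  rw [δ2_apply, δ1_apply, negOnePow_add_one (a₀ + 1), map_zsmul, neg_smul]
  exact add_neg_cancel _

theorem δ2_injective [Module.Flat ℤ (Q.X (b₀ + 1 + 1))] :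
    Function.Injective (δ2 P Q a₀ b₀) := fun _ _ h =>
  Module.Flat.rTensor_preserves_injective_linearMap (M := IQ Q b₀) _
    (IP P a₀).subtype_injective (congrArg Prod.snd h)

theorem gmap_surjective : Function.Surjective (gmap P Q a₀ b₀) :=
  Function.Surjective.prodMap
    (LinearMap.rTensor_surjective _ (toIP_surjective P a₀))
    (LinearMap.lTensor_surjective _ (toIQ_surjective Q b₀))

theorem δ1_comp_gmap : (δ1 P Q a₀ b₀).comp (gmap P Q a₀ b₀) = δG1 P Q a₀ b₀ := by
  refine LinearMap.ext fun ⟨u, v⟩ => ?_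
  rw [LinearMap.comp_apply, gmap_apply, δ1_apply, ← LinearMap.rTensor_comp_apply,
    ← LinearMap.lTensor_comp_apply]
  rfl

/-- The differential `(P ⊗ Q)^{a+b-2} → (P ⊗ Q)^{a+b-1}` on `P^{a-1} ⊗ Q^{b-1}`. -/
noncomputable def dMid : P.X (a₀ + 1) ⊗[ℤ] Q.X (b₀ + 1) →ₗ[ℤ] G1 P Q a₀ b₀ :=
  (((a₀ + 1).negOnePow : ℤ) • (dQl Q b₀).lTensor _).prod ((dPl P a₀).rTensor _)

theorem dMid_apply (t : P.X (a₀ + 1) ⊗[ℤ] Q.X (b₀ + 1)) : dMid P Q a₀ b₀ t =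
    (((a₀ + 1).negOnePow : ℤ) • (dQl Q b₀).lTensor _ t, (dPl P a₀).rTensor _ t) :=
  rfl

theorem dMid_mem_Nsub (t : P.X (a₀ + 1) ⊗[ℤ] Q.X (b₀ + 1)) :
    dMid P Q a₀ b₀ t ∈ Nsub P Q a₀ b₀ := by
  induction t with
  | zero => rw [map_zero]; exact zero_mem _
  | add x y hx hy => rw [map_add]; exact add_mem hx hy
  | tmul x y => exact Submodule.subset_span (.inl (.inl (.inl (.inr ⟨x, y, rfl⟩))))

theorem gmap_dMid (t : P.X (a₀ + 1) ⊗[ℤ] Q.X (b₀ + 1)) :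
    gmap P Q a₀ b₀ (dMid P Q a₀ b₀ t) = δ2 P Q a₀ b₀
      (TensorProduct.map (toIP P a₀) (toIQ Q b₀) t) := by
  induction t with
  | zero => exact (map_zero (δ2 P Q a₀ b₀)).symm
  | add x y hx hy =>
    rw [map_add, map_add, map_add, hx, hy]
    exact (map_add (δ2 P Q a₀ b₀) _ _).symm
  | tmul x y =>
    rw [dMid_apply, gmap_apply, δ2_apply, map_zsmul]
    rfl

theorem inl_ker_tensor_mem_Nsub (u : LinearMap.ker (dPl P a₀) ⊗[ℤ] Q.X (b₀ + 1 + 1)) :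
    (((LinearMap.ker (dPl P a₀)).subtype.rTensor _ u, 0) : G1 P Q a₀ b₀) ∈ Nsub P Q a₀ b₀ := by
  induction u with
  | zero => rw [map_zero]; exact zero_mem _
  | add x y hx hy =>
    rw [map_add]
    have := add_mem hx hy
    rwa [Prod.mk_add_mk, add_zero] at this
  | tmul x y => exact Submodule.subset_span (.inl (.inr ⟨x, y, rfl⟩))

theorem inr_tensor_ker_mem_Nsub (v : P.X (a₀ + 1 + 1) ⊗[ℤ] LinearMap.ker (dQl Q b₀)) :
    ((0, (LinearMap.ker (dQl Q b₀)).subtype.lTensor _ v) : G1 P Q a₀ b₀) ∈ Nsub P Q a₀ b₀ := by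
  induction v with
  | zero => rw [map_zero]; exact zero_mem _
  | add x y hx hy =>
    rw [map_add]
    have := add_mem hx hy
    rwa [Prod.mk_add_mk, add_zero] at this
  | tmul x y => exact Submodule.subset_span (.inr ⟨x, y, rfl⟩)

theorem ker_gmap_le_Nsub : LinearMap.ker (gmap P Q a₀ b₀) ≤ Nsub P Q a₀ b₀ := by
  rintro ⟨u, v⟩ h
  have hu : (toIP P a₀).rTensor (Q.X (b₀ + 1 + 1)) u = 0 := congrArg Prod.fst h
  have hv : (toIQ Q b₀).lTensor (P.X (a₀ + 1 + 1)) v = 0 := congrArg Prod.snd h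
  have hexP : Function.Exact (LinearMap.ker (dPl P a₀)).subtype (toIP P a₀) := by
    rw [LinearMap.exact_iff, ker_toIP, Submodule.range_subtype]
  have hexQ : Function.Exact (LinearMap.ker (dQl Q b₀)).subtype (toIQ Q b₀) := by
    rw [LinearMap.exact_iff, ker_toIQ, Submodule.range_subtype]
  obtain ⟨u, rfl⟩ := (rTensor_exact _ hexP (toIP_surjective P a₀) _).1 hu
  obtain ⟨v, rfl⟩ := (lTensor_exact _ hexQ (toIQ_surjective Q b₀) _).1 hv
  have := add_mem (inl_ker_tensor_mem_Nsub P Q a₀ b₀ u) (inr_tensor_ker_mem_Nsub P Q a₀ b₀ v)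
  rwa [Prod.mk_add_mk, add_zero, zero_add] at this

theorem Nsub_le_comap_gmap :
    Nsub P Q a₀ b₀ ≤ (LinearMap.range (δ2 P Q a₀ b₀)).comap (gmap P Q a₀ b₀) := by
  have hP : ∀ x, dPl P a₀ x = 0 → ∀ y : Q.X (b₀ + 1 + 1), gmap P Q a₀ b₀ (x ⊗ₜ y, 0) = 0 := by
    intro x hx y
    have : toIP P a₀ x = 0 := Subtype.ext hx
    rw [gmap_apply, LinearMap.rTensor_tmul, this, zero_tmul, map_zero]
    rfl
  have hQ : ∀ (x : P.X (a₀ + 1 + 1)) (y), dQl Q b₀ y = 0 → gmap P Q a₀ b₀ (0, x ⊗ₜ y) = 0 := by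
    intro x y hy
    have : toIQ Q b₀ y = 0 := Subtype.ext hy
    rw [gmap_apply, LinearMap.lTensor_tmul, this, tmul_zero, map_zero]
    rfl
  rw [Nsub, Submodule.span_le]
  rintro w ((((⟨x, y, rfl⟩ | ⟨x, y, rfl⟩) | ⟨x, y, rfl⟩) | ⟨x, y, rfl⟩) | ⟨x, y, rfl⟩)
  · exact ⟨0, (map_zero _).trans (hP _ (P.dsq a₀ x) y).symm⟩
  · exact ⟨_, (gmap_dMid P Q a₀ b₀ (x ⊗ₜ y)).symm⟩
  · have h : dQl Q b₀ (((a₀ + 1 + 1).negOnePow : ℤ) • Q.d b₀ y) = 0 := by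
      rw [map_zsmul]
      exact (congrArg _ (Q.dsq b₀ y)).trans (smul_zero _)
    rw [← tmul_smul]
    exact ⟨0, (map_zero _).trans (hQ x _ h).symm⟩
  · exact ⟨0, (map_zero _).trans (hP _ x.2 y).symm⟩
  · exact ⟨0, (map_zero _).trans (hQ x _ y.2).symm⟩

theorem comap_gmap_le_Nsub :
    (LinearMap.range (δ2 P Q a₀ b₀)).comap (gmap P Q a₀ b₀) ≤ Nsub P Q a₀ b₀ := by
  rintro w ⟨z, hz⟩
  obtain ⟨t, rfl⟩ := TensorProduct.map_surjective (toIP_surjective P a₀)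
    (toIQ_surjective Q b₀) z
  have h : w - dMid P Q a₀ b₀ t ∈ LinearMap.ker (gmap P Q a₀ b₀) := by
    rw [LinearMap.mem_ker, map_sub, gmap_dMid, ← hz, sub_self]
  simpa using add_mem (ker_gmap_le_Nsub P Q a₀ b₀ h) (dMid_mem_Nsub P Q a₀ b₀ t)

theorem statement3
    -- `P` and `Q` vanish above degrees `a = a₀+1+1` and `b = b₀+1+1`
    (htrivP : ∀ x : ℤ, a₀ + 1 + 1 < x → Subsingleton (P.X x))
    (htrivQ : ∀ y : ℤ, b₀ + 1 + 1 < y → Subsingleton (Q.X y))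
    -- `P^a` and `Q^b` are flat over `ℤ`
    (hPflat : Module.Flat ℤ (P.X (a₀ + 1 + 1)))
    (hQflat : Module.Flat ℤ (Q.X (b₀ + 1 + 1))) :
    -- the three-term complex is a complex, and its first map is injective
    -- (so that `τ_{≥ a+b−1}` only modifies it by dividing out `Im δ2`)
    ((δ1 P Q a₀ b₀).comp (δ2 P Q a₀ b₀) = 0 ∧
      Function.Injective (δ2 P Q a₀ b₀)) ∧
    -- the quotient of `τ_{≥ a+b−1}(P ⊗ Q)` by the kernel subcomplex is
    -- isomorphic (hence quasi-isomorphic), compatibly with the differentials,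
    -- to `τ_{≥ a+b−1}` of the three-term complex
    (∃ φ : (Q1 P Q a₀ b₀) →ₗ[ℤ]
        (_ ⧸ LinearMap.range (δ2 P Q a₀ b₀)),
      Function.Bijective φ ∧
      (∀ w : G1 P Q a₀ b₀,
        φ (Submodule.Quotient.mk w) = Submodule.Quotient.mk (gmap P Q a₀ b₀ w)) ∧
      (δ1 P Q a₀ b₀).comp (gmap P Q a₀ b₀) = δG1 P Q a₀ b₀) ∧
    -- hence its class in the derived category is `H^a(P)[−a] ⊗^L H^b(Q)[−b]`:
    -- the top cohomology is `H^a(P) ⊗ H^b(Q)` …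
    (∃ e : ((P.X (a₀ + 1 + 1) ⊗[ℤ] Q.X (b₀ + 1 + 1)) ⧸
        LinearMap.range (δ1 P Q a₀ b₀)) ≃ₗ[ℤ] ((HaP P a₀) ⊗[ℤ] (HbQ Q b₀)),
      ∀ (x : P.X (a₀ + 1 + 1)) (y : Q.X (b₀ + 1 + 1)),
        e (Submodule.Quotient.mk (x ⊗ₜ y)) =
          (Submodule.Quotient.mk x : HaP P a₀) ⊗ₜ
            (Submodule.Quotient.mk y : HbQ Q b₀)) ∧
    -- … and the middle cohomology is `Tor₁^ℤ(H^a(P), H^b(Q))`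
    Nonempty
      ((LinearMap.ker (δ1 P Q a₀ b₀) ⧸
          Submodule.comap (LinearMap.ker (δ1 P Q a₀ b₀)).subtype
            (LinearMap.range (δ2 P Q a₀ b₀))) ≃ₗ[ℤ]
        (((Tor (ModuleCat.{0} ℤ) 1).obj
            (ModuleCat.of ℤ (HaP P a₀))).obj (ModuleCat.of ℤ (HbQ Q b₀)))) := by
  refine ⟨⟨δ1_comp_δ2 P Q a₀ b₀, δ2_injective P Q a₀ b₀⟩,
    ⟨Submodule.mapQ _ _ (gmap P Q a₀ b₀) (Nsub_le_comap_gmap P Q a₀ b₀), ⟨?_, ?_⟩, fun w => rfl,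
      δ1_comp_gmap P Q a₀ b₀⟩,
    exists_quotient_range_coprod_equiv (IP P a₀) (IQ Q b₀) _ (negOnePow_mul_self _), ?_⟩
  · rw [← LinearMap.ker_eq_bot, Submodule.ker_mapQ, eq_bot_iff, Submodule.map_le_iff_le_comap]
    intro w hw
    exact (Submodule.Quotient.mk_eq_zero _).2 (comap_gmap_le_Nsub P Q a₀ b₀ hw)
  · intro z
    obtain ⟨z, rfl⟩ := Submodule.Quotient.mk_surjective _ z
    obtain ⟨w, rfl⟩ := gmap_surjective P Q a₀ b₀ z
    exact ⟨Submodule.Quotient.mk w, rfl⟩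
  · have hmid : ∃ f : LinearMap.ker (δ1 P Q a₀ b₀) →ₗ[ℤ]
        LinearMap.ker ((IQ Q b₀).subtype.lTensor (HaP P a₀)), Function.Surjective f ∧
        ∀ t, f t = 0 ↔ t ∈ Submodule.comap (LinearMap.ker (δ1 P Q a₀ b₀)).subtype
          (LinearMap.range (δ2 P Q a₀ b₀)) :=
      exists_ker_koszul_to_ker_lTensor_subtype (IP P a₀) (IQ Q b₀) _ _
        (negOnePow_mul_self (a₀ + 1)) (negOnePow_add_one (a₀ + 1))
    obtain ⟨f, hf, hf'⟩ := hmid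
    obtain ⟨e⟩ := nonempty_quotient_equiv_of_surjective f hf _ hf'
    obtain ⟨e'⟩ := nonempty_Tor_one_equiv_ker_lTensor_subtype
      (ModuleCat.of ℤ (HaP P a₀)) (IQ Q b₀)
    exact ⟨e.trans e'.symm⟩

end Stmt3
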